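/- There exist absolute constants K > 0 and c > 0 such that the following holds. Let V be a set of n ≥ 1 vertices and let E be a finite family of hedges, where each hedge e ∈ E is a finite set of unordered pairs of distinct vertices of V. Let R ≥ 1 be an upper bound, over all e ∈ E, on the number of connected components containing at least two vertices of the graph on V whose edge set is e. Then for every ε ∈ (0,1) there exist a subset Ê ⊆ E and nonnegative weights ŵ : Ê → ℝ with |Ê| ≤ K·n·R²·(log₂(2nR/ε))^c / ε² such that for every S ⊆ V: (1−ε)·cut(S) ≤ Σ_{e ∈ Ê cut by S} ŵ(e) ≤ (1+ε)·cut(S). -/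

import Mathlib

/-- A set `S` of vertices cuts a hedge `e` (a finite set of unordered pairs of
vertices) if some pair in `e` has one endpoint in `S` and the other outside `S`. -/
def HedgeCut {n : ℕ} (e : Finset (Sym2 (Fin n))) (S : Set (Fin n)) : Prop :=
  ∃ u v : Fin n, s(u, v) ∈ e ∧ u ∈ S ∧ v ∉ S

section
open scoped Classical
open Module Finset

lemma harmonic_cast_nonneg (n : ℕ) : (0 : ℝ) ≤ (harmonic n : ℝ) := by
  have : (0 : ℚ) ≤ harmonic n := by unfold harmonic; positivity
  exact_mod_cast this

lemma sum_mul_sum_Ico_div_le {k X : ℕ → ℝ} (hkpos : ∀ j, 0 < k j)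
    (hksucc : ∀ j, k (j + 1) = 2 * k j) (hX : ∀ j, 0 ≤ X j) (L : ℕ) :
    ∑ j ∈ range L, k j * ∑ l ∈ Ico j L, X l * (1 / k l) ≤ 2 * ∑ l ∈ range L, X l := by
  have hgeom : ∀ l, ∑ j ∈ range (l + 1), k j ≤ 2 * k l := by
    intro l
    induction l with
    | zero => simpa using by linarith [hkpos 0]
    | succ l ih => rw [sum_range_succ]; linarith [hksucc l]
  calc _ = ∑ l ∈ range L, (X l * (1 / k l)) * ∑ j ∈ range (l + 1), k j := by
        simp only [mul_sum]
        rw [sum_comm' (s' := fun l => range (l + 1)) (t' := range L) fun j l => by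
          simp only [mem_range, mem_Ico]; omega]
        exact sum_congr rfl fun l _ => sum_congr rfl fun j _ => mul_comm _ _
    _ ≤ ∑ l ∈ range L, 2 * X l := by
        refine sum_le_sum fun l _ => ?_
        have := hkpos l
        have := hX l
        calc _ ≤ X l * (1 / k l) * (2 * k l) :=
              mul_le_mul_of_nonneg_left (hgeom l) (by positivity)
          _ = 2 * X l := by field_simp
    _ = _ := by rw [mul_sum]

variable {V ι : Type*}

/-- Exponential moment of the number of hits when sampling with replacement. -/
lemma sum_exp_card_filter_le (E : Finset ι) (hE : E.Nonempty) (g : ι → Prop) [DecidablePred g]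
    (M : ℕ) {t : ℝ}
    (ht : |t| ≤ 1) :
    ∑ f : Fin M → E, Real.exp (t * (#{j | g (f j)} - M * #{i ∈ E | g i} / #E)) ≤
      #E ^ M * Real.exp (M * #{i ∈ E | g i} / #E * t ^ 2) := by
  set X : ℝ := ((#{i ∈ E | g i} : ℕ) : ℝ)
  have hEpos : (0 : ℝ) < #E := by exact_mod_cast hE.card_pos
  have hsum : ∑ e : E, Real.exp (t * if g e then 1 else 0) ≤
      #E * Real.exp (X / #E * (t + t ^ 2)) := by
    have h1 : ∑ e : E, Real.exp (t * if g e then 1 else 0) = #E + X * (Real.exp t - 1) := by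
      rw [sum_coe_sort E fun i => Real.exp (t * if g i then 1 else 0)]
      have : ∀ i ∈ E, Real.exp (t * if g i then 1 else 0) =
          1 + (if g i then 1 else 0) * (Real.exp t - 1) := by
        intro i _; split_ifs <;> simp
      rw [sum_congr rfl this, sum_add_distrib, ← sum_mul, sum_boole]
      simp [X]
    have h2 : Real.exp t - 1 ≤ t + t ^ 2 := by
      have := (abs_le.1 (Real.abs_exp_sub_one_sub_id_le ht)).2
      linarith
    have hX : 0 ≤ X := by positivity
    rw [h1]
    calc #E + X * (Real.exp t - 1) ≤ #E + X * (t + t ^ 2) := by gcongr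
      _ = #E * (X / #E * (t + t ^ 2) + 1) := by field_simp; ring
      _ ≤ _ := by gcongr; exact Real.add_one_le_exp _
  have hpow := Fintype.sum_pow (fun e : E => Real.exp (t * if g e then 1 else 0)) M
  calc _ = Real.exp (-(t * (M * X / #E))) *
        (∑ e : E, Real.exp (t * if g e then 1 else 0)) ^ M := by
        rw [hpow, mul_sum]
        refine sum_congr rfl fun f _ => ?_
        rw [← Real.exp_sum, ← Real.exp_add, ← mul_sum, sum_boole]
        congr 1; ring
    _ ≤ Real.exp (-(t * (M * X / #E))) * (#E * Real.exp (X / #E * (t + t ^ 2))) ^ M := by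
        gcongr
    _ = _ := by
        rw [mul_pow, ← Real.exp_nat_mul, mul_left_comm, ← Real.exp_add]
        congr 2; ring

variable [AddCommGroup V] [Module (ZMod 2) V] [Fintype ι]

/-- The total weight of the subspaces `K i` that miss the vector `x`. -/
noncomputable def missWeight (K : ι → Submodule (ZMod 2) V) (w : ι → ℝ) (x : V) : ℝ :=
  ∑ i with x ∉ K i, w i

/-- The total weight of the subspaces `K i` that do not contain `B`. -/
noncomputable def spanWeight (K : ι → Submodule (ZMod 2) V) (w : ι → ℝ)
    (B : Submodule (ZMod 2) V) : ℝ :=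
  ∑ i with ¬ B ≤ K i, w i

variable {K : ι → Submodule (ZMod 2) V} {w : ι → ℝ}

lemma missWeight_nonneg (hw : ∀ i, 0 ≤ w i) (x : V) : 0 ≤ missWeight K w x :=
  sum_nonneg fun i _ => hw i

/-- One step of weighted random contraction. -/
lemma exp_neg_missWeight_le {B : Submodule (ZMod 2) V} (hw : ∀ i, 0 ≤ w i) {r : ℕ}
    (hB : (r + 1 : ℝ) ≤ spanWeight K w B) {b : ℝ} (hb : 8 ≤ b) {x : V} (hx : x ∈ B) :
    Real.exp (-(b + 2 / (r + 1)) * missWeight K w x) ≤ (1 / 16) ^ (r + 1) +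
      ∑ i with ¬ B ≤ K i, w i / spanWeight K w B *
        (if x ∈ K i then Real.exp (-b * missWeight K w x) else 0) := by
  set W := spanWeight K w B with hW
  set m := missWeight K w x with hm
  have hm0 : 0 ≤ m := missWeight_nonneg hw x
  have hr : (0 : ℝ) < r + 1 := by positivity
  have hWpos : 0 < W := hr.trans_le hB
  have hrest : 0 ≤ ∑ i with ¬ B ≤ K i, w i / W *
      (if x ∈ K i then Real.exp (-b * m) else 0) := by
    refine sum_nonneg fun i _ => mul_nonneg (div_nonneg (hw i) hWpos.le) ?_
    split_ifs <;> positivity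
  rcases le_or_gt (W / 2) m with hbig | hsmall
  · have h16 : Real.exp (-4) ≤ 1 / 16 := by
      have h1 : (2 : ℝ) ≤ Real.exp 1 := by linarith [Real.add_one_le_exp (1 : ℝ)]
      have h4 : Real.exp 4 = Real.exp 1 ^ 4 := by rw [← Real.exp_nat_mul]; norm_num
      have : (16 : ℝ) ≤ Real.exp 4 := by
        rw [h4]; calc (16 : ℝ) = 2 ^ 4 := by norm_num
          _ ≤ _ := by gcongr
      rw [Real.exp_neg, one_div]
      gcongr
    have : Real.exp (-(b + 2 / (r + 1)) * m) ≤ (1 / 16) ^ (r + 1) := by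
      calc Real.exp (-(b + 2 / (r + 1)) * m) ≤ Real.exp ((r + 1 : ℕ) * (-4)) := by
            apply Real.exp_le_exp.2
            have : 0 ≤ 2 / (r + 1 : ℝ) * m := by positivity
            push_cast
            nlinarith
        _ = Real.exp (-4) ^ (r + 1) := Real.exp_nat_mul _ _
        _ ≤ _ := by gcongr
    linarith
  · have hsplit : ∑ i with ¬ B ≤ K i, w i / W * (if x ∈ K i then Real.exp (-b * m) else 0) =
        (W - m) / W * Real.exp (-b * m) := by
      have h1 : W = (∑ i with ¬ B ≤ K i, if x ∈ K i then w i else 0) + m := by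
        have : m = ∑ i with ¬ B ≤ K i, if x ∈ K i then 0 else w i := by
          rw [hm, missWeight, sum_filter, sum_filter]
          refine sum_congr rfl fun i _ => ?_
          by_cases h : x ∈ K i
          · simp [h]
          · have : ¬ B ≤ K i := fun h' => h (h' hx)
            simp [h, this]
        rw [this, ← sum_add_distrib, hW, spanWeight]
        refine sum_congr rfl fun i _ => ?_
        split_ifs <;> simp
      rw [eq_sub_of_add_eq h1.symm |>.symm, sum_div, sum_mul]
      refine sum_congr rfl fun i _ => ?_
      split_ifs <;> simp
    rw [hsplit]
    have ht : m / W ≤ 1 / 2 := by rw [div_le_iff₀ hWpos]; linarith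
    have ht0 : 0 ≤ m / W := by positivity
    have key : Real.exp (-(2 / (r + 1)) * m) ≤ (W - m) / W := by
      have h1 : Real.exp (-(2 / (r + 1)) * m) ≤ Real.exp (-(2 * (m / W))) := by
        apply Real.exp_le_exp.2
        have : m / W ≤ m / (r + 1) := by gcongr
        have e : -(2 / (r + 1)) * m = -(2 * (m / (r + 1))) := by ring
        rw [e]; linarith
      have h2 : (W - m) / W = 1 - m / W := by field_simp
      rw [h2]
      refine h1.trans ?_
      rw [Real.exp_neg]
      have h3 := Real.add_one_le_exp (2 * (m / W))
      refine inv_le_of_inv_le₀ (by linarith) (le_trans ?_ h3)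
      rw [inv_le_iff_one_le_mul₀ (by linarith)]
      nlinarith
    have hexp : Real.exp (-(b + 2 / (r + 1)) * m) =
        Real.exp (-(2 / (r + 1)) * m) * Real.exp (-b * m) := by
      rw [← Real.exp_add]; ring_nf
    rw [hexp]
    have := mul_le_mul_of_nonneg_right key (Real.exp_pos (-b * m)).le
    have : (0 : ℝ) ≤ (1 / 16) ^ (r + 1) := by positivity
    linarith

variable [Fintype V]

lemma card_filter_mem_submodule (B : Submodule (ZMod 2) V) :
    #{x | x ∈ B} = 2 ^ finrank (ZMod 2) B := by
  have h := Module.natCard_eq_pow_finrank (K := ZMod 2) (V := B)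
  rw [Nat.card_zmod] at h
  rw [← h, Nat.card_eq_fintype_card, Fintype.card_subtype]

/-- Weighted counting of the sets of subspaces missed by a vector: few of them have small
weight. -/
lemma sum_exp_neg_missWeight_le {A : Submodule (ZMod 2) V} (hw : ∀ i, 0 ≤ w i)
    (hA : ∀ i, w i ≠ 0 → A ≤ K i)
    (hstrong : ∀ B, A ≤ B → (finrank (ZMod 2) B : ℝ) ≤ finrank (ZMod 2) A + spanWeight K w B)
    (r : ℕ) : ∀ B, A ≤ B → finrank (ZMod 2) B ≤ finrank (ZMod 2) A + r →
      ∑ x with x ∈ B, Real.exp (-(8 + 2 * (harmonic r : ℝ)) * missWeight K w x) ≤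
        2 ^ finrank (ZMod 2) A * (8 / 7 - 1 / 7 * (1 / 8 : ℝ) ^ r) := by
  induction r with
  | zero =>
    intro B hAB hB
    have hBA : A = B := Submodule.eq_of_le_of_finrank_le hAB (by simpa using hB)
    subst hBA
    calc _ ≤ ∑ x with x ∈ A, (1 : ℝ) := by
          refine sum_le_sum fun x _ => Real.exp_le_one_iff.2 ?_
          have := missWeight_nonneg (K := K) hw x
          simp; linarith
      _ = _ := by
          rw [sum_const, card_filter_mem_submodule]; norm_num
  | succ r ih =>
    intro B hAB hB
    have hH : (8 : ℝ) + 2 * (harmonic (r + 1) : ℝ) = (8 + 2 * (harmonic r : ℝ)) + 2 / (r + 1) := by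
      rw [harmonic_succ]; push_cast; ring
    have hH0 : (0 : ℝ) ≤ harmonic r := harmonic_cast_nonneg _
    rw [hH]
    by_cases hlt : finrank (ZMod 2) B ≤ finrank (ZMod 2) A + r
    · calc _ ≤ ∑ x with x ∈ B, Real.exp (-(8 + 2 * (harmonic r : ℝ)) * missWeight K w x) := by
            refine sum_le_sum fun x _ => Real.exp_le_exp.2 ?_
            have := missWeight_nonneg (K := K) hw x
            have : 0 ≤ 2 / (r + 1 : ℝ) * missWeight K w x := by positivity
            linarith
        _ ≤ _ := ih B hAB hlt
        _ ≤ _ := by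
            have : (1 / 8 : ℝ) ^ (r + 1) ≤ (1 / 8) ^ r :=
              pow_le_pow_of_le_one (by norm_num) (by norm_num) (by omega)
            gcongr
    · have hBr : finrank (ZMod 2) B = finrank (ZMod 2) A + (r + 1) := by omega
      have hW : (r + 1 : ℝ) ≤ spanWeight K w B := by
        have := hstrong B hAB
        rw [hBr] at this; push_cast at this; linarith
      have hWpos : 0 < spanWeight K w B := lt_of_lt_of_le (by positivity) hW
      set c : ℝ := 2 ^ finrank (ZMod 2) A * (8 / 7 - 1 / 7 * (1 / 8 : ℝ) ^ r) with hc
      calc _ ≤ ∑ x with x ∈ B, ((1 / 16 : ℝ) ^ (r + 1) +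
            ∑ i with ¬ B ≤ K i, w i / spanWeight K w B * (if x ∈ K i then
              Real.exp (-(8 + 2 * (harmonic r : ℝ)) * missWeight K w x) else 0)) := by
            refine sum_le_sum fun x hx => ?_
            exact exp_neg_missWeight_le hw hW (by linarith) (by simpa using hx)
        _ = 2 ^ finrank (ZMod 2) B * (1 / 16 : ℝ) ^ (r + 1) +
            ∑ i with ¬ B ≤ K i, w i / spanWeight K w B * ∑ x with x ∈ B ⊓ K i,
              Real.exp (-(8 + 2 * (harmonic r : ℝ)) * missWeight K w x) := by
            rw [sum_add_distrib, sum_const, card_filter_mem_submodule, sum_comm]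
            congr 1
            · simp
            · refine sum_congr rfl fun i _ => ?_
              rw [← mul_sum, ← sum_filter, filter_filter]
              simp [Submodule.mem_inf]
        _ ≤ 2 ^ finrank (ZMod 2) B * (1 / 16 : ℝ) ^ (r + 1) +
            ∑ i with ¬ B ≤ K i, w i / spanWeight K w B * c := by
            refine add_le_add le_rfl (sum_le_sum fun i hi => ?_)
            rcases eq_or_ne (w i) 0 with h0 | h0
            · simp [h0]
            · refine mul_le_mul_of_nonneg_left ?_ (div_nonneg (hw i) hWpos.le)
              refine ih _ (le_inf hAB (hA i h0)) ?_
              have hlt' : B ⊓ K i < B := inf_lt_left.2 (by simpa using hi)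
              have := Submodule.finrank_lt_finrank_of_lt hlt'
              omega
        _ = _ := by
            rw [← sum_mul, ← sum_div]
            change _ + spanWeight K w B / spanWeight K w B * c = _
            rw [div_self hWpos.ne', hBr, hc, pow_add, mul_assoc, ← mul_pow]
            norm_num
            ring

/-- Sampling `M` members of `E` with replacement approximates, simultaneously for all `x`, the
number of members of `E` missing `x`. -/
lemma exists_sample {A : Submodule (ZMod 2) V} (hw : ∀ i, 0 ≤ w i)
    (hA : ∀ i, w i ≠ 0 → A ≤ K i)
    (hstrong : ∀ B, A ≤ B → (finrank (ZMod 2) B : ℝ) ≤ finrank (ZMod 2) A + spanWeight K w B)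
    {E : Finset ι} (hE : E.Nonempty) {κ : ℝ} (hκ : 0 < κ) (hwE : ∀ i ∈ E, 1 / κ ≤ w i)
    {δ : ℝ} (hδ : 0 < δ) (hδ1 : δ ≤ 1) {M : ℕ}
    (hM : 4 * (8 + 2 * (harmonic (finrank (ZMod 2) V) : ℝ)) * #E ≤ M * κ * δ ^ 2) :
    ∃ f : Fin M → E, ∀ x, |#E / M * (#{j | x ∉ K (f j)} : ℝ) - #{i ∈ E | x ∉ K i}| ≤
      δ * κ * missWeight K w x := by
  set β : ℝ := 8 + 2 * (harmonic (finrank (ZMod 2) V) : ℝ) with hβ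
  have hH0 : (0 : ℝ) ≤ harmonic (finrank (ZMod 2) V) := harmonic_cast_nonneg _
  have hEpos : (0 : ℝ) < #E := by exact_mod_cast hE.card_pos
  have hMpos : (0 : ℝ) < M := by
    have h1 : 0 < 4 * β * #E := by positivity
    have h2 : 0 < M * (κ * δ ^ 2) := by linarith
    exact pos_of_mul_pos_left h2 (by positivity)
  have hcut : ∀ x, (#{i ∈ E | x ∉ K i} : ℝ) ≤ κ * missWeight K w x := by
    intro x
    calc (#{i ∈ E | x ∉ K i} : ℝ) = κ * ∑ i ∈ E with x ∉ K i, 1 / κ := by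
          rw [sum_const, nsmul_eq_mul]; field_simp
      _ ≤ κ * ∑ i ∈ E with x ∉ K i, w i := by
          gcongr with i hi
          exact hwE i (mem_filter.1 hi).1
      _ ≤ _ := by
          gcongr
          exact sum_le_sum_of_subset_of_nonneg
            (fun i => by simp +contextual) fun i _ _ => hw i
  have hcount : ∑ x with x ∉ A, Real.exp (-β * missWeight K w x) ≤
      2 ^ finrank (ZMod 2) A * (1 / 7) := by
    have h1 := sum_exp_neg_missWeight_le hw hA hstrong (finrank (ZMod 2) V) ⊤ le_top
      (by rw [finrank_top]; omega)
    rw [← hβ] at h1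
    have h2 : ∑ x with x ∈ A, Real.exp (-β * missWeight K w x) = 2 ^ finrank (ZMod 2) A := by
      have : ∀ x ∈ ({x | x ∈ A} : Finset V), Real.exp (-β * missWeight K w x) = 1 := by
        intro x hx
        have : missWeight K w x = 0 := by
          refine sum_eq_zero fun i hi => ?_
          by_contra h0
          exact (mem_filter.1 hi).2 (hA i h0 (mem_filter.1 hx).2)
        simp [this]
      rw [sum_congr rfl this, sum_const, card_filter_mem_submodule]
      simp
    have h3 := sum_filter_add_sum_filter_not univ (· ∈ A)
      fun x => Real.exp (-β * missWeight K w x)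
    simp only [Submodule.mem_top, filter_true] at h1
    have h4 : (0 : ℝ) ≤ 2 ^ finrank (ZMod 2) A * (1 / 7 * (1 / 8) ^ finrank (ZMod 2) V) := by
      positivity
    linarith
  -- deviation and tolerance at `x`, and the exponential potential
  let D : (Fin M → E) → V → ℝ := fun f x =>
    #{j | x ∉ K (f j)} - M * #{i ∈ E | x ∉ K i} / #E
  let a : V → ℝ := fun x => δ * κ * missWeight K w x * M / #E
  let Ψ : (Fin M → E) → V → ℝ := fun f x =>
    Real.exp (δ / 2 * D f x - δ / 2 * a x) + Real.exp (-(δ / 2) * D f x - δ / 2 * a x)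
  have hΨ : ∀ x, ∑ f, Ψ f x ≤ #E ^ M * (2 * Real.exp (-β * missWeight K w x)) := by
    intro x
    have h0 : Real.exp (M * #{i ∈ E | x ∉ K i} / #E * (δ / 2) ^ 2) * Real.exp (-(δ / 2 * a x)) ≤
        Real.exp (-β * missWeight K w x) := by
      rw [← Real.exp_add]
      apply Real.exp_le_exp.2
      have hm := missWeight_nonneg (K := K) hw x
      have h1 : M * (#{i ∈ E | x ∉ K i} : ℝ) / #E * (δ / 2) ^ 2 ≤
          M * (κ * missWeight K w x) / #E * (δ / 2) ^ 2 := by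
        gcongr; exact hcut x
      have h2 : β * missWeight K w x ≤ M * κ * δ ^ 2 / (4 * #E) * missWeight K w x := by
        gcongr
        rw [le_div_iff₀ (by positivity)]
        linarith
      have h3 : M * (κ * missWeight K w x) / #E * (δ / 2) ^ 2 + -(δ / 2 * a x) =
          -(M * κ * δ ^ 2 / (4 * #E) * missWeight K w x) := by
        simp only [a]; field_simp; ring
      linarith
    have hs : ∀ t : ℝ, |t| ≤ 1 → t ^ 2 = (δ / 2) ^ 2 →
        ∑ f, Real.exp (t * D f x - δ / 2 * a x) ≤
          #E ^ M * Real.exp (-β * missWeight K w x) := by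
      intro t ht ht2
      have h1 := sum_exp_card_filter_le E hE (fun i => x ∉ K i) M ht
      rw [ht2] at h1
      calc ∑ f, Real.exp (t * D f x - δ / 2 * a x) =
            (∑ f, Real.exp (t * D f x)) * Real.exp (-(δ / 2 * a x)) := by
            rw [sum_mul]
            refine sum_congr rfl fun f _ => ?_
            rw [← Real.exp_add, sub_eq_add_neg]
        _ ≤ (#E ^ M * Real.exp (M * #{i ∈ E | x ∉ K i} / #E * (δ / 2) ^ 2)) *
            Real.exp (-(δ / 2 * a x)) :=
            mul_le_mul_of_nonneg_right h1 (Real.exp_pos _).le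
        _ ≤ _ := by rw [mul_assoc]; gcongr
    have h1 := hs (δ / 2) (by rw [abs_of_pos] <;> linarith) rfl
    have h2 := hs (-(δ / 2)) (by rw [abs_neg, abs_of_pos] <;> linarith) (by ring)
    simp only [Ψ, sum_add_distrib]
    linarith
  obtain ⟨f, hf⟩ : ∃ f, ∑ x with x ∉ A, Ψ f x < 2 ^ finrank (ZMod 2) A := by
    by_contra! hcon
    have h1 : ∑ f : Fin M → E, (2 : ℝ) ^ finrank (ZMod 2) A ≤ ∑ f, ∑ x with x ∉ A, Ψ f x :=
      sum_le_sum fun f _ => hcon f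
    rw [sum_const, card_univ, Fintype.card_fun, Fintype.card_fin, Fintype.card_coe, sum_comm,
      nsmul_eq_mul] at h1
    have h2 : ∑ x with x ∉ A, ∑ f, Ψ f x ≤ #E ^ M * (2 * (2 ^ finrank (ZMod 2) A * (1 / 7))) := by
      calc _ ≤ ∑ x with x ∉ A, #E ^ M * (2 * Real.exp (-β * missWeight K w x)) :=
            sum_le_sum fun x _ => hΨ x
        _ = #E ^ M * (2 * ∑ x with x ∉ A, Real.exp (-β * missWeight K w x)) := by
            rw [mul_sum, mul_sum]
        _ ≤ _ := by gcongr
    have h3 : (0 : ℝ) < #E ^ M * 2 ^ finrank (ZMod 2) A := by positivity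
    push_cast at h1
    linarith
  refine ⟨f, fun x => ?_⟩
  by_cases hx : x ∈ A
  · have hmem : ∀ i ∈ E, x ∈ K i := fun i hi =>
      hA i (ne_of_gt (lt_of_lt_of_le (by positivity) (hwE i hi))) hx
    have h1 : #{j | x ∉ K (f j)} = 0 := by
      rw [card_eq_zero, filter_eq_empty_iff]
      exact fun j _ => not_not.2 (hmem _ (f j).2)
    have h2 : #{i ∈ E | x ∉ K i} = 0 := by
      rw [card_eq_zero, filter_eq_empty_iff]
      exact fun i hi => not_not.2 (hmem i hi)
    rw [h1, h2]
    have := missWeight_nonneg (K := K) hw x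
    simp only [Nat.cast_zero, mul_zero, sub_zero, abs_zero]
    positivity
  by_contra! hfail
  have hdev : a x < |D f x| := by
    have hDx : D f x = M / #E * (#E / M * (#{j | x ∉ K (f j)} : ℝ) - #{i ∈ E | x ∉ K i}) := by
      simp only [D]; field_simp
    have : |D f x| = M / #E * |#E / M * (#{j | x ∉ K (f j)} : ℝ) - #{i ∈ E | x ∉ K i}| := by
      rw [hDx, abs_mul, abs_of_pos (by positivity)]
    rw [this]
    calc a x = M / #E * (δ * κ * missWeight K w x) := by simp only [a]; ring
      _ < _ := by gcongr
  have hone : 1 ≤ Ψ f x := by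
    have e1 := Real.exp_pos (δ / 2 * D f x - δ / 2 * a x)
    have e2 := Real.exp_pos (-(δ / 2) * D f x - δ / 2 * a x)
    rcases lt_abs.1 hdev with h | h
    · have : 1 ≤ Real.exp (δ / 2 * D f x - δ / 2 * a x) := Real.one_le_exp (by nlinarith)
      simp only [Ψ]; linarith
    · have : 1 ≤ Real.exp (-(δ / 2) * D f x - δ / 2 * a x) := Real.one_le_exp (by nlinarith)
      simp only [Ψ]; linarith
  have hcoset : ∀ y ∈ A, Ψ f (x + y) = Ψ f x := by
    intro y hy
    have hmem : ∀ i, w i ≠ 0 → (x + y ∈ K i ↔ x ∈ K i) := fun i hi =>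
      (K i).add_mem_iff_left (hA i hi hy)
    have hmemE : ∀ i ∈ E, (x + y ∈ K i ↔ x ∈ K i) := fun i hi =>
      hmem i (ne_of_gt (lt_of_lt_of_le (by positivity) (hwE i hi)))
    have h1 : missWeight K w (x + y) = missWeight K w x := by
      simp only [missWeight, sum_filter]
      refine sum_congr rfl fun i _ => ?_
      rcases eq_or_ne (w i) 0 with h | h
      · simp [h]
      · rw [hmem i h]
    have h2 : D f (x + y) = D f x := by
      simp only [D]
      rw [filter_congr fun i hi => not_congr (hmemE i hi),
        filter_congr fun j _ => not_congr (hmemE _ (f j).2)]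
    simp only [Ψ, a, h1, h2]
  have hsub : ∑ y with y ∈ A, Ψ f (x + y) ≤ ∑ z with z ∉ A, Ψ f z := by
    rw [← sum_image (g := (x + ·)) (f := Ψ f) fun _ _ _ _ h => add_left_cancel h]
    refine sum_le_sum_of_subset_of_nonneg (fun z hz => ?_) fun z _ _ => by
      simp only [Ψ]; positivity
    obtain ⟨y, hy, rfl⟩ := mem_image.1 hz
    simp only [mem_filter, mem_univ, true_and] at hy ⊢
    rwa [A.add_mem_iff_left hy]
  have : (2 : ℝ) ^ finrank (ZMod 2) A ≤ ∑ y with y ∈ A, Ψ f (x + y) := by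
    calc (2 : ℝ) ^ finrank (ZMod 2) A = ∑ y with y ∈ A, (1 : ℝ) := by
          rw [sum_const, card_filter_mem_submodule]; simp
      _ ≤ _ := sum_le_sum fun y hy => by rwa [hcoset y (mem_filter.1 hy).2]
  linarith

/-- Weighted form of `exists_sample`. -/
lemma exists_layer_weights {A : Submodule (ZMod 2) V} (hw : ∀ i, 0 ≤ w i)
    (hA : ∀ i, w i ≠ 0 → A ≤ K i)
    (hstrong : ∀ B, A ≤ B → (finrank (ZMod 2) B : ℝ) ≤ finrank (ZMod 2) A + spanWeight K w B)
    {E : Finset ι} {κ : ℝ} (hκ : 0 < κ) (hwE : ∀ i ∈ E, 1 / κ ≤ w i) {d : ℕ}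
    (hEd : (#E : ℝ) ≤ 2 * κ * d) {δ : ℝ} (hδ : 0 < δ) (hδ1 : δ ≤ 1) :
    ∃ (F : Finset ι) (ω : ι → ℝ), (∀ i, 0 ≤ ω i) ∧ (∀ i, i ∉ F → ω i = 0) ∧
      (#F : ℝ) ≤ 9 * (8 + 2 * (harmonic (finrank (ZMod 2) V) : ℝ)) / δ ^ 2 * d ∧
      ∀ x, |missWeight K ω x - #{i ∈ E | x ∉ K i}| ≤ δ * κ * missWeight K w x := by
  set β : ℝ := 8 + 2 * (harmonic (finrank (ZMod 2) V) : ℝ) with hβ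
  have hβ8 : 8 ≤ β := by
    have : (0 : ℝ) ≤ harmonic (finrank (ZMod 2) V) := harmonic_cast_nonneg _
    linarith
  rcases E.eq_empty_or_nonempty with rfl | hE
  · refine ⟨∅, 0, fun _ => le_rfl, fun _ _ => rfl, by simp; positivity, fun x => ?_⟩
    have := missWeight_nonneg (K := K) hw x
    have h0 : missWeight K 0 x = 0 := by simp [missWeight]
    rw [h0]
    simp
    positivity
  have hEpos : (0 : ℝ) < #E := by exact_mod_cast hE.card_pos
  have hd : (1 : ℝ) ≤ d := by
    have : d ≠ 0 := by rintro rfl; simp at hEd; simp [hEd] at hE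
    exact_mod_cast Nat.one_le_iff_ne_zero.2 this
  set M : ℕ := ⌈4 * β * #E / (κ * δ ^ 2)⌉₊ with hMdef
  obtain ⟨f, hf⟩ := exists_sample (M := M) hw hA hstrong hE hκ hwE hδ hδ1 (by
    rw [← hβ, mul_assoc (M : ℝ), ← div_le_iff₀ (by positivity)]
    exact Nat.le_ceil _)
  refine ⟨univ.image fun j => (f j : ι), fun i => #E / M * (#{j | (f j : ι) = i} : ℝ),
    fun i => by positivity, fun i hi => ?_, ?_, fun x => ?_⟩
  · have : #{j | (f j : ι) = i} = 0 := by
      rw [card_eq_zero, filter_eq_empty_iff]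
      intro j _ h
      exact hi (mem_image.2 ⟨j, mem_univ j, h⟩)
    simp [this]
  · have h1 : (#(univ.image fun j => (f j : ι)) : ℝ) ≤ M := by
      exact_mod_cast card_image_le.trans (by simp)
    have h2 : (M : ℝ) ≤ 4 * β * #E / (κ * δ ^ 2) + 1 := (Nat.ceil_lt_add_one (by positivity)).le
    have h3 : 4 * β * #E / (κ * δ ^ 2) ≤ 8 * β / δ ^ 2 * d := by
      rw [div_le_iff₀ (by positivity)]
      calc 4 * β * #E ≤ 4 * β * (2 * κ * d) := by gcongr
        _ = _ := by field_simp; ring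
    have h4 : 1 ≤ β / δ ^ 2 * d := by
      have : 1 ≤ β / δ ^ 2 := by
        rw [le_div_iff₀ (by positivity)]
        nlinarith
      exact one_le_mul_of_one_le_of_one_le this hd
    have h5 : 9 * β / δ ^ 2 * d = 8 * β / δ ^ 2 * d + β / δ ^ 2 * d := by ring
    linarith
  · have : missWeight K (fun i => #E / M * (#{j | (f j : ι) = i} : ℝ)) x =
        #E / M * (#{j | x ∉ K (f j)} : ℝ) := by
      rw [missWeight, ← mul_sum, card_eq_sum_card_fiberwise (f := fun j => (f j : ι))
        (t := {i | x ∉ K i}) (fun j => by simp)]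
      push_cast
      congr 1
      refine sum_congr rfl fun i hi => ?_
      rw [filter_filter]
      congr 2
      ext j
      simp only [mem_filter, mem_univ, true_and] at hi ⊢
      exact ⟨fun h => ⟨h ▸ hi, h⟩, fun h => h.2⟩
    rw [this]
    exact hf x

/-- Maximizers of `B ↦ #{i | B ≤ K i} + k * dim B` can be chosen monotone in `k`
(the principal partition). -/
lemma exists_monotone_maximizers (K : ι → Submodule (ZMod 2) V) {k : ℕ → ℝ} (hk : Monotone k) :
    ∃ A : ℕ → Submodule (ZMod 2) V, Monotone A ∧ ∀ j B,
      (#{i | B ≤ K i} : ℝ) + k j * finrank (ZMod 2) B ≤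
        #{i | A j ≤ K i} + k j * finrank (ZMod 2) (A j) := by
  have : Finite (Submodule (ZMod 2) V) := Finite.of_injective _ SetLike.coe_injective
  choose A' hA' using fun j => Finite.exists_max fun B : Submodule (ZMod 2) V =>
    (#{i | B ≤ K i} : ℝ) + k j * finrank (ZMod 2) B
  refine ⟨partialSups A', (partialSups A').monotone, fun j => ?_⟩
  induction j with
  | zero => rw [partialSups_zero]; exact hA' 0
  | succ j ih =>
    intro B
    refine (hA' (j + 1) B).trans ?_
    rw [partialSups_add_one]
    set P := partialSups A' j
    set Q := A' (j + 1)
    have hdim : (finrank (ZMod 2) ↥(P ⊔ Q) : ℝ) + finrank (ZMod 2) ↥(P ⊓ Q) =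
        finrank (ZMod 2) P + finrank (ZMod 2) Q := by
      exact_mod_cast Submodule.finrank_sup_add_finrank_inf_eq P Q
    have hcard : (#{i | P ≤ K i} : ℝ) + #{i | Q ≤ K i} ≤
        #{i | P ⊔ Q ≤ K i} + #{i | P ⊓ Q ≤ K i} := by
      have h1 : ({i | P ⊔ Q ≤ K i} : Finset ι) =
          ({i | P ≤ K i} : Finset ι) ∩ ({i | Q ≤ K i} : Finset ι) := by
        ext i; simp
      have h2 : ({i | P ≤ K i} : Finset ι) ∪ ({i | Q ≤ K i} : Finset ι) ⊆
          ({i | P ⊓ Q ≤ K i} : Finset ι) := by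
        intro i
        simp only [mem_union, mem_filter, mem_univ, true_and]
        rintro (h | h)
        · exact inf_le_left.trans h
        · exact inf_le_right.trans h
      have h3 := card_union_add_card_inter ({i | P ≤ K i} : Finset ι) {i | Q ≤ K i}
      have h4 := card_le_card h2
      rw [h1]
      exact_mod_cast (by omega)
    have hP := ih (P ⊓ Q)
    have hmono : (finrank (ZMod 2) ↥(P ⊓ Q) : ℝ) ≤ finrank (ZMod 2) P := by
      exact_mod_cast Submodule.finrank_mono (inf_le_left : P ⊓ Q ≤ P)
    have hkj := hk (Nat.le_succ j)
    have : (k (j + 1) - k j) * (finrank (ZMod 2) P - finrank (ZMod 2) ↥(P ⊓ Q) : ℝ) ≥ 0 :=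
      mul_nonneg (by simpa using hkj) (by linarith)
    have hk2 := congrArg (k (j + 1) * ·) hdim
    simp only [mul_add] at hk2
    linarith

/-- The principal partition at geometrically increasing strengths `k j`. -/
lemma exists_strength_filtration (K : ι → Submodule (ZMod 2) V) :
    ∃ (A : ℕ → Submodule (ZMod 2) V) (k : ℕ → ℝ) (L : ℕ), Monotone A ∧ (∀ j, 0 < k j) ∧
      (∀ j, k (j + 1) = 2 * k j) ∧ (∀ i, A 0 ≤ K i) ∧ A L = ⊤ ∧ ∀ j B,
      (#{i | B ≤ K i} : ℝ) + k j * finrank (ZMod 2) B ≤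
        #{i | A j ≤ K i} + k j * finrank (ZMod 2) (A j) := by
  set n := finrank (ZMod 2) V with hn
  set k : ℕ → ℝ := fun j => 2 ^ j / (n + 1) with hk
  have hkpos : ∀ j, 0 < k j := fun j => by simp only [hk]; positivity
  have hksucc : ∀ j, k (j + 1) = 2 * k j := fun j => by simp only [hk, pow_succ]; ring
  have hkmono : Monotone k := monotone_nat_of_le_succ fun j => by
    rw [hksucc]; linarith [hkpos j]
  obtain ⟨A, hAmono, hmax⟩ := exists_monotone_maximizers K hkmono
  obtain ⟨L, hL⟩ := pow_unbounded_of_one_lt ((Fintype.card ι : ℝ) * (n + 1)) one_lt_two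
  refine ⟨A, k, L, hAmono, hkpos, hksucc, ?_, ?_, hmax⟩
  · have h1 := hmax 0 ⊥
    have h3 : k 0 * finrank (ZMod 2) (A 0) < 1 := by
      have : (finrank (ZMod 2) (A 0) : ℝ) ≤ n := by exact_mod_cast Submodule.finrank_le (A 0)
      simp only [hk]
      rw [pow_zero, one_div, inv_mul_lt_iff₀ (by positivity)]
      linarith
    simp only [bot_le, filter_true, finrank_bot, Nat.cast_zero, mul_zero, add_zero] at h1
    have h4 : (#(univ : Finset ι) : ℝ) < #{i | A 0 ≤ K i} + 1 := by linarith
    have h5 : #(univ : Finset ι) < #{i | A 0 ≤ K i} + 1 := by exact_mod_cast h4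
    have h6 := eq_of_subset_of_card_le (subset_univ {i | A 0 ≤ K i}) (by omega)
    exact fun i => (filter_eq_self.1 h6) i (mem_univ i)
  · by_contra hne
    have h1 := hmax L ⊤
    rw [finrank_top] at h1
    have h2 : finrank (ZMod 2) (A L) < n := Submodule.finrank_lt hne
    have h3 : (finrank (ZMod 2) (A L) : ℝ) + 1 ≤ n := by exact_mod_cast h2
    have h4 : (#{i | A L ≤ K i} : ℝ) ≤ Fintype.card ι := by exact_mod_cast card_le_univ _
    have h5 : (Fintype.card ι : ℝ) < k L := by
      simp only [hk]; rw [lt_div_iff₀ (by positivity)]; exact hL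
    have h6 : (0 : ℝ) ≤ #{i | ⊤ ≤ K i} := by positivity
    have h7 : k L * (finrank (ZMod 2) (A L) + 1) ≤ k L * n :=
      mul_le_mul_of_nonneg_left h3 (hkpos L).le
    linarith

/-- A family of subspaces has a small reweighted subfamily approximating, for every vector `x`,
the number of members missing `x`. -/
theorem exists_missWeight_sparsifier (K : ι → Submodule (ZMod 2) V) {ε : ℝ} (hε : 0 < ε)
    (hε1 : ε ≤ 1) :
    ∃ (F : Finset ι) (ω : ι → ℝ), (∀ i, 0 ≤ ω i) ∧ (∀ i, i ∉ F → ω i = 0) ∧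
      (#F : ℝ) ≤ 36 * (8 + 2 * (harmonic (finrank (ZMod 2) V) : ℝ)) / ε ^ 2 * finrank (ZMod 2) V ∧
      ∀ x, |missWeight K ω x - #{i | x ∉ K i}| ≤ ε * #{i | x ∉ K i} := by
  set n := finrank (ZMod 2) V with hn
  set β : ℝ := 8 + 2 * (harmonic n : ℝ) with hβ
  obtain ⟨A, k, L, hAmono, hkpos, hksucc, hA0, hL, hAmax⟩ := exists_strength_filtration K
  have hdim : ∀ B : Submodule (ZMod 2) V, (finrank (ZMod 2) B : ℝ) ≤ n := fun B => by
    exact_mod_cast Submodule.finrank_le B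
  let N : Submodule (ZMod 2) V → Finset ι := fun B => {i | B ≤ K i}
  have hN : ∀ {B i}, i ∈ N B ↔ B ≤ K i := by simp [N]
  have hNanti : ∀ {B C}, B ≤ C → N C ⊆ N B := fun hBC i hi => hN.2 (hBC.trans (hN.1 hi))
  have hmax : ∀ j B, (#(N B) : ℝ) + k j * finrank (ZMod 2) B ≤
      #(N (A j)) + k j * finrank (ZMod 2) (A j) := hAmax
  have hN0 : N (A 0) = univ := by ext i; simp [hN, hA0 i]
  let E : ℕ → Finset ι := fun j => N (A j) \ N (A (j + 1))
  let d : ℕ → ℕ := fun j => finrank (ZMod 2) (A (j + 1)) - finrank (ZMod 2) (A j)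
  have hd : ∀ j, (d j : ℝ) = finrank (ZMod 2) (A (j + 1)) - finrank (ZMod 2) (A j) := fun j =>
    Nat.cast_sub (Submodule.finrank_mono (hAmono (Nat.le_succ j)))
  have hEcard : ∀ j, (#(E j) : ℝ) = #(N (A j)) - #(N (A (j + 1))) := fun j =>
    cast_card_sdiff (hNanti (hAmono (Nat.le_succ j)))
  have hEd : ∀ j, (#(E j) : ℝ) ≤ 2 * k j * d j := fun j => by
    have := hmax (j + 1) (A j)
    rw [hksucc] at this
    rw [hEcard, hd]; linarith
  -- the layers above `j`, with geometrically decreasing weights, are strong over `A j`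
  let w : ℕ → ι → ℝ := fun j i => ∑ l ∈ Ico j L, if i ∈ E l then 1 / k l else 0
  have hw : ∀ j i, 0 ≤ w j i := fun j i => sum_nonneg fun l _ => by
    split_ifs
    · exact (one_div_pos.2 (hkpos l)).le
    · exact le_rfl
  have hwA : ∀ j i, w j i ≠ 0 → A j ≤ K i := by
    intro j i hne
    obtain ⟨l, hl, hl'⟩ := exists_ne_zero_of_sum_ne_zero hne
    have hi : i ∈ E l := by by_contra h; simp [h] at hl'
    exact (hAmono (mem_Ico.1 hl).1).trans (hN.1 (mem_sdiff.1 hi).1)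
  have hwE : ∀ j < L, ∀ i ∈ E j, 1 / k j ≤ w j i := by
    intro j hj i hi
    have := single_le_sum (f := fun l => if i ∈ E l then 1 / k l else 0)
      (fun l _ => by
        split_ifs
        · exact (one_div_pos.2 (hkpos l)).le
        · exact le_rfl) (left_mem_Ico.2 hj)
    rwa [if_pos hi] at this
  have hlayer : ∀ B l, (finrank (ZMod 2) ↥(A (l + 1) ⊓ B) : ℝ) - finrank (ZMod 2) ↥(A l ⊓ B) ≤
      #{i ∈ E l | ¬ B ≤ K i} * (1 / k l) := by
    intro B l
    have hle : A l ≤ A (l + 1) := hAmono (Nat.le_succ l)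
    set C := (A (l + 1) ⊓ B) ⊔ A l with hC
    have hinf : (A (l + 1) ⊓ B) ⊓ A l = A l ⊓ B := by
      rw [inf_right_comm, inf_eq_right.2 hle]
    have hdimC : (finrank (ZMod 2) C : ℝ) + finrank (ZMod 2) ↥(A l ⊓ B) =
        finrank (ZMod 2) ↥(A (l + 1) ⊓ B) + finrank (ZMod 2) (A l) := by
      rw [← hinf]
      exact_mod_cast Submodule.finrank_sup_add_finrank_inf_eq (A (l + 1) ⊓ B) (A l)
    have hsub : N (A l) \ N C ⊆ {i ∈ E l | ¬ B ≤ K i} := by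
      intro i
      simp only [E, mem_sdiff, mem_filter, hN]
      rintro ⟨h1, h2⟩
      exact ⟨⟨h1, fun h => h2 (sup_le (inf_le_left.trans h) h1)⟩,
        fun h => h2 (sup_le (inf_le_right.trans h) h1)⟩
    have hcard : (#(N (A l)) : ℝ) - #(N C) ≤ #{i ∈ E l | ¬ B ≤ K i} := by
      rw [← cast_card_sdiff (hNanti le_sup_right)]
      exact_mod_cast card_le_card hsub
    have := hmax l C
    rw [mul_one_div, le_div_iff₀ (hkpos l)]
    have hdimC' : (finrank (ZMod 2) ↥(A (l + 1) ⊓ B) : ℝ) - finrank (ZMod 2) ↥(A l ⊓ B) =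
      finrank (ZMod 2) C - finrank (ZMod 2) (A l) := by linarith
    rw [hdimC', sub_mul]
    linarith
  have hsumw : ∀ j (p : ι → Prop) [DecidablePred p], ∑ i with p i, w j i =
      ∑ l ∈ Ico j L, (#{i ∈ E l | p i} : ℝ) * (1 / k l) := by
    intro j p _
    simp only [w]
    rw [sum_comm]
    refine sum_congr rfl fun l _ => ?_
    rw [← sum_filter, sum_const, nsmul_eq_mul]
    congr 3
    ext i; simp [and_comm]
  have hstrong : ∀ j < L, ∀ B, A j ≤ B →
      (finrank (ZMod 2) B : ℝ) ≤ finrank (ZMod 2) (A j) + spanWeight K (w j) B := by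
    intro j hj B hB
    have h1 : ∑ l ∈ Ico j L, ((finrank (ZMod 2) ↥(A (l + 1) ⊓ B) : ℝ) -
        finrank (ZMod 2) ↥(A l ⊓ B)) = finrank (ZMod 2) B - finrank (ZMod 2) (A j) := by
      rw [sum_Ico_sub (fun l => (finrank (ZMod 2) ↥(A l ⊓ B) : ℝ)) hj.le, hL, top_inf_eq,
        inf_eq_left.2 hB]
    have h2 : ∑ l ∈ Ico j L, ((finrank (ZMod 2) ↥(A (l + 1) ⊓ B) : ℝ) -
        finrank (ZMod 2) ↥(A l ⊓ B)) ≤ spanWeight K (w j) B := by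
      rw [spanWeight, hsumw]
      exact sum_le_sum fun l _ => hlayer B l
    linarith
  have hex : ∀ j : ℕ, ∃ (F : Finset ι) (ω : ι → ℝ), j < L → (∀ i, 0 ≤ ω i) ∧
      (∀ i, i ∉ F → ω i = 0) ∧ (#F : ℝ) ≤ 9 * β / (ε / 2) ^ 2 * d j ∧
      ∀ x, |missWeight K ω x - #{i ∈ E j | x ∉ K i}| ≤ ε / 2 * k j * missWeight K (w j) x := by
    intro j
    by_cases hj : j < L
    · obtain ⟨F, ω, h⟩ := exists_layer_weights (hw j) (hwA j) (hstrong j hj) (hkpos j) (hwE j hj)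
        (hEd j) (half_pos hε) (by linarith)
      exact ⟨F, ω, fun _ => h⟩
    · exact ⟨∅, 0, fun h => absurd h hj⟩
  choose F ω hFω using hex
  refine ⟨(range L).biUnion F, fun i => ∑ j ∈ range L, ω j i, fun i => ?_, fun i hi => ?_, ?_,
    fun x => ?_⟩
  · exact sum_nonneg fun j hj => (hFω j (mem_range.1 hj)).1 i
  · refine sum_eq_zero fun j hj => (hFω j (mem_range.1 hj)).2.1 i fun h => hi ?_
    exact mem_biUnion.2 ⟨j, hj, h⟩
  · have hsumd : ∑ j ∈ range L, (d j : ℝ) ≤ n := by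
      simp only [hd]
      rw [sum_range_sub (fun j => (finrank (ZMod 2) (A j) : ℝ))]
      have : (0 : ℝ) ≤ finrank (ZMod 2) (A 0) := by positivity
      linarith [hdim (A L)]
    have hβ0 : 0 ≤ β := by
      have : (0 : ℝ) ≤ harmonic n := harmonic_cast_nonneg _
      linarith
    calc (#((range L).biUnion F) : ℝ) ≤ ∑ j ∈ range L, (#(F j) : ℝ) := by
          exact_mod_cast card_biUnion_le
      _ ≤ ∑ j ∈ range L, 9 * β / (ε / 2) ^ 2 * d j :=
          sum_le_sum fun j hj => (hFω j (mem_range.1 hj)).2.2.1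
      _ = 36 * β / ε ^ 2 * ∑ j ∈ range L, (d j : ℝ) := by
          rw [← mul_sum]; ring
      _ ≤ _ := by gcongr
  · let X : ℕ → ℝ := fun l => #{i ∈ E l | x ∉ K i}
    have hX : ∑ l ∈ range L, X l = #{i | x ∉ K i} := by
      have h1 : ∀ l, X l = (#{i ∈ N (A l) | x ∉ K i} : ℝ) - #{i ∈ N (A (l + 1)) | x ∉ K i} := by
        intro l
        rw [← cast_card_sdiff (filter_subset_filter _ (hNanti (hAmono (Nat.le_succ l))))]
        simp only [X, E]
        congr 2
        ext i; simp only [mem_filter, mem_sdiff]; tauto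
      simp only [h1]
      rw [sum_range_sub' (fun l => (#{i ∈ N (A l) | x ∉ K i} : ℝ)), hN0, hL]
      have : #{i ∈ N ⊤ | x ∉ K i} = 0 := by
        rw [card_eq_zero, filter_eq_empty_iff]
        exact fun i hi => not_not.2 (hN.1 hi trivial)
      simp [this]
    have hmiss : missWeight K (fun i => ∑ j ∈ range L, ω j i) x =
        ∑ j ∈ range L, missWeight K (ω j) x := sum_comm
    rw [hmiss, ← hX, ← sum_sub_distrib]
    calc |∑ j ∈ range L, (missWeight K (ω j) x - X j)| ≤
          ∑ j ∈ range L, |missWeight K (ω j) x - X j| := abs_sum_le_sum_abs _ _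
      _ ≤ ∑ j ∈ range L, ε / 2 * k j * missWeight K (w j) x :=
          sum_le_sum fun j hj => (hFω j (mem_range.1 hj)).2.2.2 x
      _ = ε / 2 * ∑ j ∈ range L, k j * ∑ l ∈ Ico j L, X l * (1 / k l) := by
          rw [mul_sum]
          refine sum_congr rfl fun j _ => ?_
          rw [missWeight, hsumw, mul_assoc]
      _ ≤ ε / 2 * (2 * ∑ l ∈ range L, X l) := by
          gcongr
          exact sum_mul_sum_Ico_div_le hkpos hksucc (fun l => Nat.cast_nonneg _) L
      _ = _ := by ring

/-- The 0/1 vectors constant on every pair of a hedge, i.e. the vertex sets not cutting it. -/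
def uncutSubmodule {n : ℕ} (e : Finset (Sym2 (Fin n))) : Submodule (ZMod 2) (Fin n → ZMod 2) where
  carrier := {x | ∀ u v, s(u, v) ∈ e → x u = x v}
  add_mem' hx hy u v h := by simp [hx u v h, hy u v h]
  zero_mem' _ _ _ := rfl
  smul_mem' c x hx u v h := by simp [hx u v h]

lemma hedgeCut_iff_indicator_notMem {n : ℕ} (e : Finset (Sym2 (Fin n))) (S : Set (Fin n)) :
    HedgeCut e S ↔ S.indicator (1 : Fin n → ZMod 2) ∉ uncutSubmodule e := by
  constructor
  · rintro ⟨u, v, he, hu, hv⟩ h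
    simpa [hu, hv] using h u v he
  · intro h
    by_contra hcut
    refine h fun u v he => ?_
    by_cases hu : u ∈ S <;> by_cases hv : v ∈ S
    · simp [hu, hv]
    · exact absurd ⟨u, v, he, hu, hv⟩ hcut
    · exact absurd ⟨v, u, Sym2.eq_swap ▸ he, hv, hu⟩ hcut
    · simp [hu, hv]

end

/-- near-linear size cut sparsifiers for hedge-graphs, with quadratic
dependence on the maximum number R of nontrivial connected components of a hedge. -/
theorem stmt_19 :
    ∃ K c : ℝ, 0 < K ∧ 0 < c ∧
      ∀ (n : ℕ), 1 ≤ n →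
      ∀ (ι : Type) [Fintype ι], ∀ E : ι → Finset (Sym2 (Fin n)),
        (∀ i, ∀ p ∈ E i, ¬ p.IsDiag) →
      ∀ R : ℕ, 1 ≤ R →
        (∀ i, Nat.card
            {C : (SimpleGraph.fromEdgeSet ((E i : Set (Sym2 (Fin n))))).ConnectedComponent //
              2 ≤ Nat.card {v : Fin n //
                (SimpleGraph.fromEdgeSet ((E i : Set (Sym2 (Fin n))))).connectedComponentMk v
                  = C}} ≤ R) →
      ∀ ε : ℝ, 0 < ε → ε < 1 →
      ∃ (Ehat : Finset ι) (what : ι → ℝ),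
        (∀ i ∈ Ehat, 0 ≤ what i) ∧
        (Ehat.card : ℝ) ≤ K * n * (R : ℝ) ^ 2 *
          (Real.logb 2 (2 * (n : ℝ) * (R : ℝ) / ε)) ^ c / ε ^ 2 ∧
        ∀ S : Set (Fin n),
          (1 - ε) * (Nat.card {i : ι // HedgeCut (E i) S} : ℝ) ≤
              ∑ i ∈ Ehat, Set.indicator {i : ι | HedgeCut (E i) S} what i ∧
            ∑ i ∈ Ehat, Set.indicator {i : ι | HedgeCut (E i) S} what i ≤
              (1 + ε) * (Nat.card {i : ι // HedgeCut (E i) S} : ℝ) := by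
  refine ⟨360, 1, by norm_num, one_pos, fun n hn ι _ E _ R hR _ ε hε hε1 => ?_⟩
  classical
  obtain ⟨F, ω, hω, hωF, hF, happrox⟩ :=
    exists_missWeight_sparsifier (fun i => uncutSubmodule (E i)) hε hε1.le
  refine ⟨F, ω, fun i _ => hω i, ?_, fun S => ?_⟩
  · rw [Module.finrank_fin_fun] at hF
    have hn1 : (1 : ℝ) ≤ n := by exact_mod_cast hn
    have hR1 : (1 : ℝ) ≤ R := by exact_mod_cast hR
    set ℓ := Real.logb 2 (2 * (n : ℝ) * R / ε) with hℓ
    have hlogn : 0 ≤ Real.log n := Real.log_nonneg hn1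
    have hℓ1 : 1 + Real.log n ≤ ℓ := by
      have h1 : Real.logb 2 (2 * n) ≤ ℓ := by
        refine Real.logb_le_logb_of_le (by norm_num) (by positivity) ?_
        rw [le_div_iff₀ hε]
        calc 2 * (n : ℝ) * ε ≤ 2 * n * 1 := by gcongr
          _ ≤ 2 * n * R := by gcongr
      have h2 : Real.logb 2 (2 * n) = 1 + Real.logb 2 n := by
        rw [Real.logb_mul (by norm_num) (by positivity), Real.logb_self_eq_one (by norm_num)]
      have h3 : Real.log n ≤ Real.logb 2 n := by
        rw [Real.logb, le_div_iff₀ (Real.log_pos (by norm_num))]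
        have : Real.log 2 ≤ 1 := by linarith [Real.log_two_lt_d9]
        nlinarith
      linarith
    have hβ : 8 + 2 * (harmonic n : ℝ) ≤ 10 * ℓ := by
      linarith [harmonic_le_one_add_log n]
    have hℓ0 : 0 ≤ ℓ := by linarith
    rw [Real.rpow_one]
    calc (F.card : ℝ) ≤ 36 * (8 + 2 * (harmonic n : ℝ)) / ε ^ 2 * n := hF
      _ ≤ 36 * (10 * ℓ) / ε ^ 2 * n := by gcongr
      _ = 360 * n * 1 ^ 2 * ℓ / ε ^ 2 := by ring
      _ ≤ _ := by gcongr
  · have h := abs_le.1 (happrox (S.indicator 1))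
    simp only [← hedgeCut_iff_indicator_notMem, missWeight] at h
    have hcard : (Nat.card {i : ι // HedgeCut (E i) S} : ℝ) =
        (Finset.univ.filter fun i => HedgeCut (E i) S).card := by
      rw [Nat.card_eq_fintype_card, Fintype.card_subtype]
    have hsum : ∑ i ∈ F, Set.indicator {i : ι | HedgeCut (E i) S} ω i =
        ∑ i with HedgeCut (E i) S, ω i := by
      rw [Finset.sum_subset (Finset.subset_univ F) fun i _ hi => by
        simp [Set.indicator_apply, hωF i hi], Finset.sum_filter]
      simp [Set.indicator_apply]
    rw [hcard, hsum]
    constructor <;> linarith [h.1, h.2]
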